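/- Let (X,T) be an NDS, let Z ⊂ X_0 and let f be a potential. Then the upper separated pressure satisfies P_up(T,f,Z) = lim_{ε→0} inf{s ∈ ℝ : 𝒫^s_{∞,ε}(T,f,Z) = 0} = lim_{ε→0} sup{s ∈ ℝ : 𝒫^s_{∞,ε}(T,f,Z) = +∞}, where 𝒫^s_{∞,ε} is the packing pre-measure (packing content) defined below. -/

import Mathlib

open Filter Set
open scoped ENNReal NNReal

noncomputable section

namespace NDS

variable {X : ℕ → Type*}

/-- The orbit maps `T_k^j : X k → X (k+j)` of a nonautonomous system. -/
def iterFrom (T : ∀ k, X k → X (k + 1)) (k : ℕ) : ∀ j, X k → X (k + j)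
  | 0 => fun x => x
  | j + 1 => fun x => T (k + j) (iterFrom T k j x)

/-- The orbit maps `T^j = T_{j-1} ∘ ⋯ ∘ T_0 : X 0 → X j`. -/
def iter (T : ∀ k, X k → X (k + 1)) : ∀ j, X 0 → X j
  | 0 => fun x => x
  | j + 1 => fun x => T j (iter T j x)

variable [∀ k, MetricSpace (X k)]

/-- The `n`-th Bowen metric on `X 0`:  `d_n^T(x,y) = max_{0 ≤ j ≤ n-1} d_j (T^j x) (T^j y)`. -/
def bowenDist (T : ∀ k, X k → X (k + 1)) (n : ℕ) (x y : X 0) : ℝ :=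
  (((Finset.range n).sup fun j => nndist (iter T j x) (iter T j y) : ℝ≥0) : ℝ)

/-- The open Bowen ball `B_n^T(x, ε)`. -/
def bowenBall (T : ∀ k, X k → X (k + 1)) (n : ℕ) (x : X 0) (ε : ℝ) : Set (X 0) :=
  {y | bowenDist T n x y < ε}

/-- The closed Bowen ball `clB_n^T(x, ε)`. -/
def bowenClosedBall (T : ∀ k, X k → X (k + 1)) (n : ℕ) (x : X 0) (ε : ℝ) : Set (X 0) :=
  {y | bowenDist T n x y ≤ ε}

/-- Birkhoff sums starting at level `k`:  `S_{k,n}^T f = Σ_{j<n} f_{k+j} ∘ T_k^j`. -/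
def birkFrom (T : ∀ k, X k → X (k + 1)) (f : ∀ k, X k → ℝ) (k n : ℕ) (x : X k) : ℝ :=
  ∑ j ∈ Finset.range n, f (k + j) (iterFrom T k j x)

/-- Birkhoff sums `S_n^T f = Σ_{j<n} f_j ∘ T^j` on `X 0`. -/
def birk (T : ∀ k, X k → X (k + 1)) (f : ∀ k, X k → ℝ) (n : ℕ) (x : X 0) : ℝ :=
  ∑ j ∈ Finset.range n, f j (iter T j x)

/-- A potential `f = {f_k}` is equicontinuous. -/
def EquicontPotential (f : ∀ k, X k → ℝ) : Prop :=
  ∀ ε : ℝ, 0 < ε → ∃ δ : ℝ, 0 < δ ∧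
    ∀ k, ∀ x y : X k, dist x y < δ → |f k x - f k y| < ε

/-- The sequence of maps `T = {T_k}` is equicontinuous. -/
def EquicontMaps (T : ∀ k, X k → X (k + 1)) : Prop :=
  ∀ ε : ℝ, 0 < ε → ∃ δ : ℝ, 0 < δ ∧
    ∀ k, ∀ x y : X k, dist x y < δ → dist (T k x) (T k y) < ε

/-- `F` is an `(n,ε)`-spanning set for `Z`. -/
def IsSpanning (T : ∀ k, X k → X (k + 1)) (n : ℕ) (ε : ℝ) (Z : Set (X 0))
    (F : Finset (X 0)) : Prop :=
  ∀ x ∈ Z, ∃ y ∈ F, bowenDist T n x y ≤ ε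

/-- `E` is an `(n,ε)`-separated set for `Z`. -/
def IsSeparated (T : ∀ k, X k → X (k + 1)) (n : ℕ) (ε : ℝ) (Z : Set (X 0))
    (E : Finset (X 0)) : Prop :=
  ↑E ⊆ Z ∧ ∀ x ∈ E, ∀ y ∈ E, x ≠ y → ε < bowenDist T n x y

/-- The partition sum `Σ_{x ∈ F} e^{S_n^T f(x)}` (valued in `ℝ≥0∞`). -/
def partSum (T : ∀ k, X k → X (k + 1)) (f : ∀ k, X k → ℝ) (n : ℕ) (F : Finset (X 0)) : ℝ≥0∞ :=
  ∑ x ∈ F, ENNReal.ofReal (Real.exp (birk T f n x))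

/-- `Q_n(T,f,Z,ε)`, infimum over `(n,ε)`-spanning sets. -/
def Qn (T : ∀ k, X k → X (k + 1)) (f : ∀ k, X k → ℝ) (Z : Set (X 0)) (n : ℕ) (ε : ℝ) : ℝ≥0∞ :=
  ⨅ (F : Finset (X 0)) (_ : IsSpanning T n ε Z F), partSum T f n F

/-- `P_n(T,f,Z,ε)`, supremum over `(n,ε)`-separated sets. -/
def Pn (T : ∀ k, X k → X (k + 1)) (f : ∀ k, X k → ℝ) (Z : Set (X 0)) (n : ℕ) (ε : ℝ) : ℝ≥0∞ :=
  ⨆ (E : Finset (X 0)) (_ : IsSeparated T n ε Z E), partSum T f n E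

/-- `liminf_n (1/n) log u n` (in `EReal`). -/
def lowRate (u : ℕ → ℝ≥0∞) : EReal :=
  Filter.atTop.liminf fun n : ℕ => (((n : ℝ)⁻¹ : ℝ) : EReal) * ENNReal.log (u n)

/-- `limsup_n (1/n) log u n` (in `EReal`). -/
def upRate (u : ℕ → ℝ≥0∞) : EReal :=
  Filter.atTop.limsup fun n : ℕ => (((n : ℝ)⁻¹ : ℝ) : EReal) * ENNReal.log (u n)

/-- Lower spanning topological pressure `Q_low(T,f,Z)`; the limit as `ε → 0` is realised as a
supremum over `ε > 0`, the quantity being monotone in `ε`. -/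
def Qlow (T : ∀ k, X k → X (k + 1)) (f : ∀ k, X k → ℝ) (Z : Set (X 0)) : EReal :=
  ⨆ (ε : ℝ) (_ : 0 < ε), lowRate fun n => Qn T f Z n ε

/-- Upper spanning topological pressure `Q_up(T,f,Z)`. -/
def Qup (T : ∀ k, X k → X (k + 1)) (f : ∀ k, X k → ℝ) (Z : Set (X 0)) : EReal :=
  ⨆ (ε : ℝ) (_ : 0 < ε), upRate fun n => Qn T f Z n ε

/-- Lower separated topological pressure `P_low(T,f,Z)`. -/
def Plow (T : ∀ k, X k → X (k + 1)) (f : ∀ k, X k → ℝ) (Z : Set (X 0)) : EReal :=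
  ⨆ (ε : ℝ) (_ : 0 < ε), lowRate fun n => Pn T f Z n ε

/-- Upper separated topological pressure `P_up(T,f,Z)`. -/
def Pup (T : ∀ k, X k → X (k + 1)) (f : ∀ k, X k → ℝ) (Z : Set (X 0)) : EReal :=
  ⨆ (ε : ℝ) (_ : 0 < ε), upRate fun n => Pn T f Z n ε

/-- The critical value `inf {s : M s = 0}` of a "measure profile" `M`, as an extended real. -/
def crit (M : ℝ → ℝ≥0∞) : EReal :=
  sInf (Real.toEReal '' {s : ℝ | M s = 0})

/-- The critical value `sup {s : M s = ∞}` of a "measure profile" `M`, as an extended real. -/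
def critSup (M : ℝ → ℝ≥0∞) : EReal :=
  sSup (Real.toEReal '' {s : ℝ | M s = ⊤})

/-- A countable family of Bowen balls (recorded by their (center, order) data) which is an
`(N,ε)`-cover of `Z`. -/
def IsBowenCover (T : ∀ k, X k → X (k + 1)) (N : ℕ) (ε : ℝ) (Z : Set (X 0))
    (C : Set (X 0 × ℕ)) : Prop :=
  C.Countable ∧ (∀ p ∈ C, N ≤ p.2) ∧ Z ⊆ ⋃ p ∈ C, bowenBall T p.2 p.1 ε

/-- A countable disjoint family of closed Bowen balls with centers in `Z` and orders `≥ N`: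
an `(N,ε)`-packing of `Z`. -/
def IsBowenPacking (T : ∀ k, X k → X (k + 1)) (N : ℕ) (ε : ℝ) (Z : Set (X 0))
    (P : Set (X 0 × ℕ)) : Prop :=
  P.Countable ∧ (∀ p ∈ P, p.1 ∈ Z ∧ N ≤ p.2) ∧
    ∀ p ∈ P, ∀ q ∈ P, p ≠ q →
      Disjoint (bowenClosedBall T p.2 p.1 ε) (bowenClosedBall T q.2 q.1 ε)

/-- `Σ_i exp (-n_i s + S_{n_i}^T f (x_i))` over a family of (center, order) pairs. -/
def ballSum (T : ∀ k, X k → X (k + 1)) (f : ∀ k, X k → ℝ) (s : ℝ) (C : Set (X 0 × ℕ)) : ℝ≥0∞ :=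
  ∑' p : C, ENNReal.ofReal (Real.exp (-(p.1.2 : ℝ) * s + birk T f p.1.2 p.1.1))

/-- The Hausdorff-type pre-measure `M^s_{N,ε}(T,f,Z)`. -/
def bowenPreMeas (T : ∀ k, X k → X (k + 1)) (f : ∀ k, X k → ℝ) (Z : Set (X 0))
    (s : ℝ) (N : ℕ) (ε : ℝ) : ℝ≥0∞ :=
  ⨅ (C : Set (X 0 × ℕ)) (_ : IsBowenCover T N ε Z C), ballSum T f s C

/-- `M^s_ε(T,f,Z) = lim_{N → ∞} M^s_{N,ε}(T,f,Z)` (an increasing limit, i.e. a supremum). -/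
def bowenMeas (T : ∀ k, X k → X (k + 1)) (f : ∀ k, X k → ℝ) (Z : Set (X 0))
    (s : ℝ) (ε : ℝ) : ℝ≥0∞ :=
  ⨆ N : ℕ, bowenPreMeas T f Z s N ε

/-- `P^B(T,f,Z,ε)`: the critical value of `s ↦ M^s_ε(T,f,Z)`. -/
def PBe (T : ∀ k, X k → X (k + 1)) (f : ∀ k, X k → ℝ) (Z : Set (X 0)) (ε : ℝ) : EReal :=
  crit fun s => bowenMeas T f Z s ε

/-- The Bowen (Pesin–Pitskel') topological pressure `P^B(T,f,Z)`; the limit as `ε → 0` is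
realised as a supremum over `ε > 0` by monotonicity. -/
def PB (T : ∀ k, X k → X (k + 1)) (f : ∀ k, X k → ℝ) (Z : Set (X 0)) : EReal :=
  ⨆ (ε : ℝ) (_ : 0 < ε), PBe T f Z ε

/-- The packing pre-measure `𝒫^s_{N,ε}(T,f,Z)`. -/
def packPre (T : ∀ k, X k → X (k + 1)) (f : ∀ k, X k → ℝ) (Z : Set (X 0))
    (s : ℝ) (N : ℕ) (ε : ℝ) : ℝ≥0∞ :=
  ⨆ (P : Set (X 0 × ℕ)) (_ : IsBowenPacking T N ε Z P), ballSum T f s P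

/-- The packing content `𝒫^s_{∞,ε}(T,f,Z) = lim_{N→∞} 𝒫^s_{N,ε}` (a decreasing limit, i.e. an
infimum). -/
def packContent (T : ∀ k, X k → X (k + 1)) (f : ∀ k, X k → ℝ) (Z : Set (X 0))
    (s : ℝ) (ε : ℝ) : ℝ≥0∞ :=
  ⨅ N : ℕ, packPre T f Z s N ε

/-- The packing measure `𝒫^s_ε(T,f,Z)`, obtained from the content by countable decompositions. -/
def packMeas (T : ∀ k, X k → X (k + 1)) (f : ∀ k, X k → ℝ) (Z : Set (X 0))
    (s : ℝ) (ε : ℝ) : ℝ≥0∞ :=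
  ⨅ (D : ℕ → Set (X 0)) (_ : Z ⊆ ⋃ i, D i), ∑' i, packContent T f (D i) s ε

/-- `P^P(T,f,Z,ε)`: the critical value of `s ↦ 𝒫^s_ε(T,f,Z)`. -/
def PPe (T : ∀ k, X k → X (k + 1)) (f : ∀ k, X k → ℝ) (Z : Set (X 0)) (ε : ℝ) : EReal :=
  crit fun s => packMeas T f Z s ε

/-- The packing topological pressure `P^P(T,f,Z)`. -/
def PP (T : ∀ k, X k → X (k + 1)) (f : ∀ k, X k → ℝ) (Z : Set (X 0)) : EReal :=
  ⨆ (ε : ℝ) (_ : 0 < ε), PPe T f Z ε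

end NDS

namespace NDS

section Aux

variable {X : ℕ → Type*} [∀ k, MetricSpace (X k)]

lemma rate_lt_iff (n : ℕ) (hn : 0 < n) (u : ℝ≥0∞) (t : ℝ) :
    (((n : ℝ)⁻¹ : ℝ) : EReal) * ENNReal.log u < (t : EReal) ↔
      u < ENNReal.ofReal (Real.exp (n * t)) := by
  have hn' : (0 : ℝ) < n := by exact_mod_cast hn
  have hinv : (0 : ℝ) < (n : ℝ)⁻¹ := by positivity
  rw [← ENNReal.log_lt_log_iff, ENNReal.log_ofReal_of_pos (Real.exp_pos _), Real.log_exp]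
  generalize ENNReal.log u = L
  induction L with
  | bot => rw [EReal.coe_mul_bot_of_pos hinv]; simp only [EReal.bot_lt_coe]
  | coe a =>
    rw [← EReal.coe_mul, EReal.coe_lt_coe_iff, EReal.coe_lt_coe_iff, inv_mul_lt_iff₀ hn']
  | top => rw [EReal.coe_mul_top_of_pos hinv]; simp

lemma lt_rate_iff (n : ℕ) (hn : 0 < n) (u : ℝ≥0∞) (t : ℝ) :
    (t : EReal) < (((n : ℝ)⁻¹ : ℝ) : EReal) * ENNReal.log u ↔
      ENNReal.ofReal (Real.exp (n * t)) < u := by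
  have hn' : (0 : ℝ) < n := by exact_mod_cast hn
  have hinv : (0 : ℝ) < (n : ℝ)⁻¹ := by positivity
  rw [← ENNReal.log_lt_log_iff, ENNReal.log_ofReal_of_pos (Real.exp_pos _), Real.log_exp]
  generalize ENNReal.log u = L
  induction L with
  | bot => rw [EReal.coe_mul_bot_of_pos hinv]; simp
  | coe a =>
    rw [← EReal.coe_mul, EReal.coe_lt_coe_iff, EReal.coe_lt_coe_iff, lt_inv_mul_iff₀ hn']
  | top => rw [EReal.coe_mul_top_of_pos hinv]; simp only [EReal.coe_lt_top]

lemma bowenDist_self (T : ∀ k, X k → X (k + 1)) (n : ℕ) (x : X 0) : bowenDist T n x x = 0 := by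
  simp [bowenDist]

lemma bowenDist_triangle (T : ∀ k, X k → X (k + 1)) (n : ℕ) (x y z : X 0) :
    bowenDist T n x y ≤ bowenDist T n x z + bowenDist T n y z := by
  unfold bowenDist
  rw [← NNReal.coe_add, NNReal.coe_le_coe]
  refine Finset.sup_le fun j hj => ?_
  refine (nndist_triangle_right _ _ (iter T j z)).trans ?_
  exact add_le_add
    (Finset.le_sup (f := fun j => nndist (iter T j x) (iter T j z)) hj)
    (Finset.le_sup (f := fun j => nndist (iter T j y) (iter T j z)) hj)

lemma exp_split (n : ℕ) (s b : ℝ) :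
    ENNReal.ofReal (Real.exp (-(n : ℝ) * s + b)) =
      ENNReal.ofReal (Real.exp (-(n : ℝ) * s)) * ENNReal.ofReal (Real.exp b) := by
  rw [Real.exp_add, ENNReal.ofReal_mul (Real.exp_pos _).le]

lemma packContent_antitone (T : ∀ k, X k → X (k + 1)) (f : ∀ k, X k → ℝ) (Z : Set (X 0))
    (ε : ℝ) {s t : ℝ} (hst : s ≤ t) : packContent T f Z t ε ≤ packContent T f Z s ε := by
  unfold packContent packPre ballSum
  refine iInf_mono fun N => iSup₂_mono fun P _ => ENNReal.tsum_le_tsum fun p => ?_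
  apply ENNReal.ofReal_le_ofReal
  apply Real.exp_le_exp.2
  have : (0 : ℝ) ≤ (p.1.2 : ℝ) := Nat.cast_nonneg _
  nlinarith

lemma critSup_le_crit (T : ∀ k, X k → X (k + 1)) (f : ∀ k, X k → ℝ) (Z : Set (X 0)) (ε : ℝ) :
    critSup (fun s => packContent T f Z s ε) ≤ crit (fun s => packContent T f Z s ε) := by
  unfold critSup crit
  refine sSup_le ?_
  rintro _ ⟨s, hs, rfl⟩
  refine le_sInf ?_
  rintro _ ⟨t, ht, rfl⟩
  rw [EReal.coe_le_coe_iff]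
  by_contra! h
  have := packContent_antitone T f Z ε h.le
  simp only [mem_ofPred_eq] at hs ht
  rw [hs, ht] at this
  simp at this

/-- The part of a packing of a given order is bounded by the separated partition sum. -/
lemma slice_le (T : ∀ k, X k → X (k + 1)) (f : ∀ k, X k → ℝ) (Z : Set (X 0))
    (s : ℝ) (N : ℕ) (ε : ℝ) (hε : 0 < ε) (P : Set (X 0 × ℕ)) (hP : IsBowenPacking T N ε Z P)
    (n : ℕ) :
    ∑' x : X 0, P.indicator (fun p : X 0 × ℕ =>
        ENNReal.ofReal (Real.exp (-(p.2 : ℝ) * s + birk T f p.2 p.1))) (x, n)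
      ≤ ENNReal.ofReal (Real.exp (-(n : ℝ) * s)) * Pn T f Z n ε := by
  classical
  rw [ENNReal.tsum_eq_iSup_sum]
  refine iSup_le fun F => ?_
  have h1 : ∑ x ∈ F, P.indicator (fun p : X 0 × ℕ =>
        ENNReal.ofReal (Real.exp (-(p.2 : ℝ) * s + birk T f p.2 p.1))) (x, n)
      = ENNReal.ofReal (Real.exp (-(n : ℝ) * s)) *
          partSum T f n (F.filter fun x => (x, n) ∈ P) := by
    unfold partSum
    rw [Finset.mul_sum, Finset.sum_filter]
    refine Finset.sum_congr rfl fun x _ => ?_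
    simp only [Set.indicator_apply, exp_split]
  rw [h1]
  gcongr
  unfold Pn
  refine le_iSup₂_of_le (F.filter fun x => (x, n) ∈ P) ⟨?_, ?_⟩ le_rfl
  · intro x hx
    simp only [Finset.coe_filter, mem_ofPred_eq] at hx
    exact (hP.2.1 _ hx.2).1
  · intro x hx y hy hxy
    simp only [Finset.mem_filter] at hx hy
    have hd := hP.2.2 _ hx.2 _ hy.2 (by simpa using hxy)
    by_contra! hle
    refine absurd (show y ∈ bowenClosedBall T n y ε from ?_) (Set.disjoint_left.1 hd hle)
    change bowenDist T n y y ≤ ε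
    rw [bowenDist_self]
    exact hε.le

lemma crit_le_upRate (T : ∀ k, X k → X (k + 1)) (f : ∀ k, X k → ℝ) (Z : Set (X 0))
    (ε : ℝ) (hε : 0 < ε) :
    crit (fun s => packContent T f Z s ε) ≤ upRate fun n => Pn T f Z n ε := by
  refine le_of_forall_gt fun c hc => ?_
  obtain ⟨t, ht1, ht2⟩ := EReal.lt_iff_exists_real_btwn.1 hc
  obtain ⟨s, hs1, hs2⟩ := EReal.lt_iff_exists_real_btwn.1 ht2
  rw [EReal.coe_lt_coe_iff] at hs1
  refine lt_of_le_of_lt (sInf_le ⟨s, ?_, rfl⟩) hs2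
  simp only [mem_ofPred_eq]
  obtain ⟨N₀, hN₀⟩ := eventually_atTop.1 (eventually_lt_of_limsup_lt ht1)
  set a : ℕ → ℝ≥0∞ := fun n => ENNReal.ofReal (Real.exp (-(s - t)) ^ n) with ha
  have hr : Real.exp (-(s - t)) < 1 := Real.exp_lt_one_iff.2 (by linarith)
  have hsum : ∑' n, a n ≠ ∞ :=
    (summable_geometric_of_lt_one (Real.exp_pos _).le hr).tsum_ofReal_ne_top
  have htail := ENNReal.tendsto_sum_nat_add a hsum
  have hbound : ∀ N, max N₀ 1 ≤ N → packContent T f Z s ε ≤ ∑' k, a (k + N) := by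
    intro N hN
    refine (iInf_le _ N).trans (iSup₂_le fun P hP => ?_)
    unfold ballSum
    rw [tsum_subtype P (fun p : X 0 × ℕ =>
        ENNReal.ofReal (Real.exp (-(p.2 : ℝ) * s + birk T f p.2 p.1))),
      ENNReal.tsum_prod', ENNReal.tsum_comm,
      ← Summable.sum_add_tsum_nat_add' (k := N) ENNReal.summable]
    rw [Finset.sum_eq_zero, zero_add]
    · refine ENNReal.tsum_le_tsum fun k => ?_
      refine (slice_le T f Z s N ε hε P hP (k + N)).trans ?_
      have hk := (rate_lt_iff (k + N) (by omega) _ t).1 (hN₀ (k + N) (by omega))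
      refine (mul_le_mul_right hk.le _).trans ?_
      rw [← ENNReal.ofReal_mul (Real.exp_pos _).le, ← Real.exp_add, ha]
      simp only
      rw [← Real.exp_nat_mul]
      apply le_of_eq
      congr 2
      ring
    · intro n hn
      rw [Finset.mem_range] at hn
      rw [ENNReal.tsum_eq_zero]
      intro x
      apply Set.indicator_of_notMem
      intro hx
      have := (hP.2.1 _ hx).2
      simp only at this
      omega
  exact le_antisymm (ge_of_tendsto htail (eventually_atTop.2 ⟨_, hbound⟩)) (zero_le)

/-- A separated set of scale `2 ε` yields a packing of radius `ε`. -/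
lemma partSum_le_packPre (T : ∀ k, X k → X (k + 1)) (f : ∀ k, X k → ℝ) (Z : Set (X 0))
    (s : ℝ) (N n : ℕ) (hn : N ≤ n) (ε : ℝ) (E : Finset (X 0))
    (hE : IsSeparated T n (2 * ε) Z E) :
    ENNReal.ofReal (Real.exp (-(n : ℝ) * s)) * partSum T f n E ≤ packPre T f Z s N ε := by
  classical
  have hinj : Function.Injective (fun x : X 0 => (x, n)) := fun x y h => by simpa using h
  refine le_iSup₂_of_le (↑(E.map ⟨_, hinj⟩) : Set (X 0 × ℕ)) ⟨?_, ?_, ?_⟩ ?_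
  · exact Finset.countable_toSet _
  · intro p hp
    simp only [Finset.coe_map, Function.Embedding.coeFn_mk, mem_image, Finset.mem_coe] at hp
    obtain ⟨x, hx, rfl⟩ := hp
    exact ⟨hE.1 hx, hn⟩
  · intro p hp q hq hpq
    simp only [Finset.coe_map, Function.Embedding.coeFn_mk, mem_image, Finset.mem_coe] at hp hq
    obtain ⟨x, hx, rfl⟩ := hp
    obtain ⟨y, hy, rfl⟩ := hq
    have hsep := hE.2 x hx y hy (fun h => hpq (by rw [h]))
    rw [Set.disjoint_left]
    intro z hzx hzy
    simp only [bowenClosedBall, mem_ofPred_eq] at hzx hzy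
    have := bowenDist_triangle T n x y z
    linarith
  · unfold ballSum
    rw [Finset.tsum_subtype' (E.map ⟨_, hinj⟩) (fun p : X 0 × ℕ =>
        ENNReal.ofReal (Real.exp (-(p.2 : ℝ) * s + birk T f p.2 p.1))), Finset.sum_map]
    unfold partSum
    rw [Finset.mul_sum]
    simp only [Function.Embedding.coeFn_mk, exp_split, le_refl]

lemma upRate_le_critSup (T : ∀ k, X k → X (k + 1)) (f : ∀ k, X k → ℝ) (Z : Set (X 0))
    (ε : ℝ) :
    (upRate fun n => Pn T f Z n (2 * ε)) ≤ critSup (fun s => packContent T f Z s ε) := by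
  refine le_of_forall_lt fun c hc => ?_
  obtain ⟨s, hs1, hs2⟩ := EReal.lt_iff_exists_real_btwn.1 hc
  obtain ⟨t, ht1, ht2⟩ := EReal.lt_iff_exists_real_btwn.1 hs2
  rw [EReal.coe_lt_coe_iff] at ht1
  refine lt_of_lt_of_le hs1 (le_sSup ⟨s, ?_, rfl⟩)
  simp only [mem_ofPred_eq]
  have hfreq := frequently_atTop.1 (frequently_lt_of_lt_limsup (h := ht2))
  unfold packContent
  rw [iInf_eq_top]
  intro N
  refine ENNReal.eq_top_of_forall_nnreal_le fun r => ?_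
  obtain ⟨m, hm⟩ := exists_nat_gt ((r : ℝ) / (t - s))
  obtain ⟨n, hn, hlt⟩ := hfreq (max (max N 1) m)
  have hlt' := (lt_rate_iff n (by omega) _ t).1 hlt
  unfold Pn at hlt'
  simp only [lt_iSup_iff] at hlt'
  obtain ⟨E, hE, hEt⟩ := hlt'
  refine le_trans ?_ (partSum_le_packPre T f Z s N n (by omega) ε E hE)
  refine le_trans ?_ (mul_le_mul_right hEt.le _)
  rw [← ENNReal.ofReal_mul (Real.exp_pos _).le, ← Real.exp_add, ← ENNReal.ofReal_coe_nnreal]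
  apply ENNReal.ofReal_le_ofReal
  have hmn : (m : ℝ) ≤ n := by exact_mod_cast (le_max_right _ _).trans hn
  have h1 : (r : ℝ) < n * (t - s) := by
    rw [div_lt_iff₀ (by linarith)] at hm
    nlinarith
  have h2 := Real.add_one_le_exp (n * (t - s))
  have h3 : -(n : ℝ) * s + n * t = n * (t - s) := by ring
  rw [h3]
  linarith

end Aux

end NDS


/-- The upper separated pressure equals, in the limit `ε → 0` (realised as a
supremum over `ε > 0`, the quantities being monotone in `ε`), both critical values of the
packing content `𝒫^s_{∞,ε}`. -/
theorem pup_eq_packingContent_critical {X : ℕ → Type*} [∀ k, MetricSpace (X k)]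
    [∀ k, CompactSpace (X k)] (T : ∀ k, X k → X (k + 1)) (hT : ∀ k, Continuous (T k))
    (f : ∀ k, X k → ℝ) (hf : ∀ k, Continuous (f k)) (Z : Set (X 0)) :
    NDS.Pup T f Z = (⨆ (ε : ℝ) (_ : 0 < ε), NDS.crit fun s => NDS.packContent T f Z s ε) ∧
      NDS.Pup T f Z = (⨆ (ε : ℝ) (_ : 0 < ε), NDS.critSup fun s => NDS.packContent T f Z s ε) := by
  have h1 : NDS.Pup T f Z ≤
      ⨆ (ε : ℝ) (_ : 0 < ε), NDS.critSup fun s => NDS.packContent T f Z s ε := by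
    refine iSup₂_le fun ε hε => ?_
    refine le_iSup₂_of_le (ε / 2) (by positivity) ?_
    have := NDS.upRate_le_critSup T f Z (ε / 2)
    rwa [mul_div_cancel₀ ε two_ne_zero] at this
  have h2 : (⨆ (ε : ℝ) (_ : 0 < ε), NDS.critSup fun s => NDS.packContent T f Z s ε) ≤
      ⨆ (ε : ℝ) (_ : 0 < ε), NDS.crit fun s => NDS.packContent T f Z s ε :=
    iSup₂_mono fun ε _ => NDS.critSup_le_crit T f Z ε
  have h3 : (⨆ (ε : ℝ) (_ : 0 < ε), NDS.crit fun s => NDS.packContent T f Z s ε) ≤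
      NDS.Pup T f Z :=
    iSup₂_mono fun ε hε => NDS.crit_le_upRate T f Z ε hε
  exact ⟨le_antisymm (h1.trans h2) h3, le_antisymm h1 (h2.trans h3)⟩
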